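/- arXiv:1906.09056 — 4 statements merged into one kernel-verified Lean document; each statement's English description precedes it below -/
import Mathlib

section
/- Let G be a simple connected graph on n ≥ 4 vertices with m edges, largest degree d₁ and second largest degree d₂ ≥ 1, and let G′ be a simple graph on the same vertex set obtained from G by adding h new edges, where 1 ≤ h ≤ n(n−1)/2 − m. Assume 2m + 2h ≤ 1 + d₁ + (n−2)d₂. Then the Kirchhoff index of G′ satisfies K(G′) ≥ n·( 1/(d₁+1) + 1/d₂ + (n−3)²/(2m + 2h − 1 − d₁ − d₂) ). -/
open Finset

/-- The eigenvalues of the Laplacian matrix of `G`, arranged in non-increasing order: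
`lapEigs G 0 = μ₁ ≥ lapEigs G 1 = μ₂ ≥ …`. -/
noncomputable def lapEigs {n : ℕ} (G : SimpleGraph (Fin n)) : Fin n → ℝ := by
  letI := Classical.decRel G.Adj
  letI := fun (a b : Fin n) => Classical.dec (a = b)
  exact fun i =>
    ((G.posSemidef_lapMatrix ℝ).isHermitian.eigenvalues ∘
      Tuple.sort (G.posSemidef_lapMatrix ℝ).isHermitian.eigenvalues) i.rev

/-- The degree sequence of `G`, arranged in non-increasing order:
`degSeq G 0 = d₁ ≥ degSeq G 1 = d₂ ≥ …`. -/
noncomputable def degSeq {n : ℕ} (G : SimpleGraph (Fin n)) : Fin n → ℕ := by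
  letI := Classical.decRel G.Adj
  exact fun i => ((fun v => G.degree v) ∘ Tuple.sort (fun v => G.degree v)) i.rev

/-- The Kirchhoff index `K(G) = n ∑_{i=1}^{n-1} 1/μᵢ`. -/
noncomputable def kirchhoffIndex {n : ℕ} (G : SimpleGraph (Fin n)) : ℝ :=
  n * ∑ i ∈ Finset.univ.filter (fun i : Fin n => (i : ℕ) < n - 1), 1 / lapEigs G i

/-- `MajorizedBy y x` (`y ⊴ x`) : every partial sum of `y` is at most the corresponding
partial sum of `x`, with equal total sums. -/
def MajorizedBy {n : ℕ} (y x : Fin n → ℝ) : Prop :=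
  (∀ k : ℕ, k < n →
      ∑ i ∈ Finset.univ.filter (fun i : Fin n => (i : ℕ) < k), y i ≤
        ∑ i ∈ Finset.univ.filter (fun i : Fin n => (i : ℕ) < k), x i) ∧
    ∑ i, y i = ∑ i, x i

namespace Matrix.IsHermitian

open Matrix

variable {V ι : Type*} [Fintype V] [DecidableEq V] {A : Matrix V V ℝ}

theorem eigenvectorBasis_dotProduct (hA : A.IsHermitian) (i j : V) :
    (hA.eigenvectorBasis i).ofLp ⬝ᵥ (hA.eigenvectorBasis j).ofLp = if i = j then 1 else 0 := by
  have h := orthonormal_iff_ite.mp hA.eigenvectorBasis.orthonormal j i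
  simpa [EuclideanSpace.inner_eq_star_dotProduct, eq_comm] using h

theorem dotProduct_self_eq_sum_sq (hA : A.IsHermitian) (b : V → ℝ) :
    b ⬝ᵥ b = ∑ j, (b ⬝ᵥ (hA.eigenvectorBasis j).ofLp) ^ 2 := by
  have h := hA.eigenvectorBasis.sum_sq_inner_right (WithLp.toLp 2 b)
  simp only [EuclideanSpace.inner_eq_star_dotProduct, star_trivial] at h
  rw [h, EuclideanSpace.real_norm_sq_eq]
  simp [dotProduct, sq]

theorem dotProduct_mulVec_sum_smul (hA : A.IsHermitian) (c : V → ℝ) :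
    (∑ j, c j • (hA.eigenvectorBasis j).ofLp) ⬝ᵥ
      A *ᵥ (∑ j, c j • (hA.eigenvectorBasis j).ofLp) = ∑ j, hA.eigenvalues j * c j ^ 2 := by
  simp only [mulVec_sum, mulVec_smul, hA.mulVec_eigenvectorBasis, sum_dotProduct,
    dotProduct_sum, smul_dotProduct, dotProduct_smul, hA.eigenvectorBasis_dotProduct]
  refine sum_congr rfl fun j _ => ?_
  simp
  ring

theorem dotProduct_mulVec_eigenvectorBasis (hA : A.IsHermitian) (j : V) :
    (hA.eigenvectorBasis j).ofLp ⬝ᵥ A *ᵥ (hA.eigenvectorBasis j).ofLp = hA.eigenvalues j := by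
  simp [hA.mulVec_eigenvectorBasis, hA.eigenvectorBasis_dotProduct]

/-- If `b bᵀ ≤ A` in the Loewner order, then `bᵀ A⁺ b ≤ 1`. -/
theorem sum_sq_div_eigenvalues_le_one (hA : A.IsHermitian) {b : V → ℝ}
    (hb : ∀ x, (b ⬝ᵥ x) ^ 2 ≤ x ⬝ᵥ A *ᵥ x) :
    ∑ j, (b ⬝ᵥ (hA.eigenvectorBasis j).ofLp) ^ 2 / hA.eigenvalues j ≤ 1 := by
  set β := fun j => b ⬝ᵥ (hA.eigenvectorBasis j).ofLp with hβ
  have h := hb (∑ j, (β j / hA.eigenvalues j) • (hA.eigenvectorBasis j).ofLp)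
  rw [hA.dotProduct_mulVec_sum_smul] at h
  have h₁ : b ⬝ᵥ ∑ j, (β j / hA.eigenvalues j) • (hA.eigenvectorBasis j).ofLp =
      ∑ j, β j ^ 2 / hA.eigenvalues j := by
    rw [dotProduct_sum]
    refine sum_congr rfl fun j _ => ?_
    rw [dotProduct_smul, smul_eq_mul]
    change _ * β j = _
    ring
  have h₂ : ∑ j, hA.eigenvalues j * (β j / hA.eigenvalues j) ^ 2 =
      ∑ j, β j ^ 2 / hA.eigenvalues j := by
    refine sum_congr rfl fun j _ => ?_
    rcases eq_or_ne (hA.eigenvalues j) 0 with h0 | h0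
    · simp [h0]
    · field_simp
  rw [h₁, h₂] at h
  by_contra! hlt
  change 1 < ∑ j, β j ^ 2 / hA.eigenvalues j at hlt
  nlinarith

/-- If `∑ bᵢ bᵢᵀ ≤ A` in the Loewner order, then the trace of the left-hand side is a combination
of the eigenvalues of `A` with weights in `[0, 1]` of total weight at most the number of the
`bᵢ`. -/
theorem exists_weights_of_sum_sq_le [Fintype ι] (hA : A.IsHermitian) {b : ι → V → ℝ}
    (hb : ∀ x, ∑ i, (b i ⬝ᵥ x) ^ 2 ≤ x ⬝ᵥ A *ᵥ x) :
    ∃ t : V → ℝ, (∀ j, 0 ≤ t j ∧ t j ≤ 1) ∧ ∑ j, t j ≤ Fintype.card ι ∧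
      ∑ i, b i ⬝ᵥ b i = ∑ j, hA.eigenvalues j * t j := by
  have hle : ∀ j, ∑ i, (b i ⬝ᵥ (hA.eigenvectorBasis j).ofLp) ^ 2 ≤ hA.eigenvalues j := fun j =>
    (hb _).trans_eq (hA.dotProduct_mulVec_eigenvectorBasis j)
  have hsum : ∀ j, 0 ≤ ∑ i, (b i ⬝ᵥ (hA.eigenvectorBasis j).ofLp) ^ 2 := fun j =>
    sum_nonneg fun i _ => sq_nonneg _
  have hnonneg : ∀ j, 0 ≤ hA.eigenvalues j := fun j => (hsum j).trans (hle j)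
  refine ⟨fun j => (∑ i, (b i ⬝ᵥ (hA.eigenvectorBasis j).ofLp) ^ 2) / hA.eigenvalues j,
    fun j => ⟨div_nonneg (hsum j) (hnonneg j), div_le_one_of_le₀ (hle j) (hnonneg j)⟩, ?_, ?_⟩
  · simp_rw [sum_div]
    rw [sum_comm]
    calc _ ≤ ∑ _i : ι, (1 : ℝ) := sum_le_sum fun i _ =>
          hA.sum_sq_div_eigenvalues_le_one fun x =>
            (single_le_sum (f := fun i => (b i ⬝ᵥ x) ^ 2) (fun _ _ => sq_nonneg _)
              (mem_univ i)).trans (hb x)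
      _ = _ := by simp
  · simp_rw [hA.dotProduct_self_eq_sum_sq]
    rw [sum_comm]
    refine sum_congr rfl fun j _ => ?_
    rcases eq_or_ne (hA.eigenvalues j) 0 with h0 | h0
    · simpa [h0] using le_antisymm ((hle j).trans_eq h0) (hsum j)
    · field_simp

end Matrix.IsHermitian

namespace SimpleGraph

open Matrix

variable {V : Type*} [Fintype V] [DecidableEq V]

/-- The image under the oriented incidence map of the normalised star with centre `u` and
leaves `S`. -/
noncomputable def starVec (u : V) (S : Finset V) : V → ℝ := fun i =>
  ((#S : ℝ) * (if i = u then 1 else 0) - if i ∈ S then 1 else 0) / √(#S : ℝ)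

theorem starVec_dotProduct (u : V) (S : Finset V) (x : V → ℝ) :
    starVec u S ⬝ᵥ x = (∑ w ∈ S, (x u - x w)) / √(#S : ℝ) := by
  simp [starVec, dotProduct, div_mul_eq_mul_div, ← sum_div, sub_mul, sum_sub_distrib]

theorem starVec_dotProduct_sq_le (u : V) (S : Finset V) (x : V → ℝ) :
    (starVec u S ⬝ᵥ x) ^ 2 ≤ ∑ w ∈ S, (x u - x w) ^ 2 := by
  rw [starVec_dotProduct, div_pow, Real.sq_sqrt (by positivity)]
  exact div_le_of_le_mul₀ (by positivity) (sum_nonneg fun _ _ => sq_nonneg _)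
    (by rw [mul_comm]; exact sq_sum_le_card_mul_sum_sq)

theorem starVec_dotProduct_self {u : V} {S : Finset V} (hu : u ∉ S) (hS : S.Nonempty) :
    starVec u S ⬝ᵥ starVec u S = #S + 1 := by
  have hpos : (0 : ℝ) < #S := by exact_mod_cast hS.card_pos
  rw [starVec_dotProduct]
  have h : ∀ w ∈ S, starVec u S u - starVec u S w = (#S + 1) / √(#S : ℝ) := fun w hw => by
    have hwu : w ≠ u := fun h => hu (h ▸ hw)
    simp only [starVec, hu, hw, hwu, if_true, if_false]
    ring
  rw [sum_congr rfl h, sum_const, nsmul_eq_mul, ← mul_div_assoc, div_div,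
    Real.mul_self_sqrt hpos.le]
  field_simp

variable (G : SimpleGraph V) [DecidableRel G.Adj]

theorem sum_le_dotProduct_lapMatrix (g : V → V → ℝ)
    (hg : ∀ i j, g i j + g j i ≤ if G.Adj i j then 1 else 0) (x : V → ℝ) :
    ∑ i, ∑ j, g i j * (x i - x j) ^ 2 ≤ x ⬝ᵥ G.lapMatrix ℝ *ᵥ x := by
  rw [← toLinearMap₂'_apply', lapMatrix_toLinearMap₂', le_div_iff₀ two_pos, mul_two]
  nth_rewrite 2 [sum_comm]
  simp_rw [← sum_add_distrib]
  refine sum_le_sum fun i _ => sum_le_sum fun j _ => ?_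
  have h := mul_le_mul_of_nonneg_right (hg i j) (sq_nonneg (x i - x j))
  rw [ite_mul, one_mul, zero_mul] at h
  linarith [sub_sq_comm (x i) (x j), congrArg (g j i * ·) (sub_sq_comm (x i) (x j))]

theorem starVec_sq_le_lapMatrix {u : V} {S : Finset V} (hS : ∀ w ∈ S, G.Adj u w) (x : V → ℝ) :
    (starVec u S ⬝ᵥ x) ^ 2 ≤ x ⬝ᵥ G.lapMatrix ℝ *ᵥ x := by
  refine (starVec_dotProduct_sq_le u S x).trans ?_
  refine le_trans (Eq.le ?_) (G.sum_le_dotProduct_lapMatrix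
    (fun i j => if i = u ∧ j ∈ S then 1 else 0) ?_ x)
  · simp [ite_and]
  · intro i j
    have hne : G.Adj i j → i ≠ j := G.ne_of_adj
    have hcomm := G.adj_comm i j
    split_ifs <;> grind

theorem starVec_add_sq_le_lapMatrix {u v : V} {S T : Finset V} (huv : u ≠ v) (hv : v ∉ S)
    (hS : ∀ w ∈ S, G.Adj u w) (hT : ∀ w ∈ T, G.Adj v w) (x : V → ℝ) :
    (starVec u S ⬝ᵥ x) ^ 2 + (starVec v T ⬝ᵥ x) ^ 2 ≤ x ⬝ᵥ G.lapMatrix ℝ *ᵥ x := by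
  refine (add_le_add (starVec_dotProduct_sq_le u S x) (starVec_dotProduct_sq_le v T x)).trans ?_
  refine le_trans (Eq.le ?_) (G.sum_le_dotProduct_lapMatrix
    (fun i j => (if i = u ∧ j ∈ S then 1 else 0) + if i = v ∧ j ∈ T then 1 else 0) ?_ x)
  · simp [ite_and, add_mul, sum_add_distrib]
  · intro i j
    have hne : G.Adj i j → i ≠ j := G.ne_of_adj
    have hcomm := G.adj_comm i j
    split_ifs <;> grind

end SimpleGraph

section LaplacianSpectrum

open Matrix

variable {n : ℕ} (G : SimpleGraph (Fin n))

theorem exists_perm_lapEigs [DecidableRel G.Adj] : ∃ σ : Equiv.Perm (Fin n),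
    ∀ i, lapEigs G i = (G.isHermitian_lapMatrix ℝ).eigenvalues (σ i) := by
  have hrel : Classical.decRel G.Adj = ‹DecidableRel G.Adj› := Subsingleton.elim _ _
  refine ⟨Fin.revPerm.trans (Tuple.sort (G.isHermitian_lapMatrix ℝ).eigenvalues), fun i => ?_⟩
  subst hrel
  simp only [lapEigs, Equiv.trans_apply, Function.comp_apply, Fin.revPerm_apply]
  congr!

theorem lapEigs_antitone : Antitone (lapEigs G) := fun i j hij => by
  unfold lapEigs
  exact Tuple.monotone_sort _ (Fin.rev_le_rev.mpr hij)

theorem lapEigs_nonneg (i : Fin n) : 0 ≤ lapEigs G i := by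
  classical
  obtain ⟨σ, hσ⟩ := exists_perm_lapEigs G
  rw [hσ]
  exact (G.posSemidef_lapMatrix ℝ).eigenvalues_nonneg _

theorem sum_lapEigs : ∑ i, lapEigs G i = 2 * (G.edgeSet.ncard : ℝ) := by
  classical
  obtain ⟨σ, hσ⟩ := exists_perm_lapEigs G
  have htr := (G.isHermitian_lapMatrix ℝ).trace_eq_sum_eigenvalues
  have hdeg := G.sum_degrees_eq_twice_card_edges
  simp_rw [hσ]
  rw [Equiv.sum_comp σ]
  rw [← SimpleGraph.coe_edgeFinset, Set.ncard_coe_finset]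
  simp only [RCLike.ofReal_real_eq_id, id_eq] at htr
  rw [← htr]
  simp only [Matrix.trace, Matrix.diag, SimpleGraph.lapMatrix, SimpleGraph.degMatrix,
    Matrix.sub_apply, diagonal_apply_eq, SimpleGraph.adjMatrix_apply, SimpleGraph.irrefl, if_false, sub_zero]
  exact_mod_cast hdeg

variable {G}

theorem existsUnique_lapEigs_eq_zero (hG : G.Connected) : ∃! i, lapEigs G i = 0 := by
  classical
  obtain ⟨σ, hσ⟩ := exists_perm_lapEigs G
  have hA := G.isHermitian_lapMatrix ℝ
  have hrank := hA.rank_eq_card_non_zero_eigs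
  have hker := G.card_connectedComponent_eq_finrank_ker_toLin'_lapMatrix
  have hcard : Fintype.card G.ConnectedComponent = 1 := by
    have := hG.preconnected.subsingleton_connectedComponent
    have := hG.nonempty
    exact Fintype.card_eq_one_iff_nonempty_unique.mpr
      ⟨⟨⟨G.connectedComponentMk (Classical.arbitrary _)⟩, fun _ => Subsingleton.elim _ _⟩⟩
  have hrn := LinearMap.finrank_range_add_finrank_ker (G.lapMatrix ℝ).toLin'
  rw [← hker, hcard, Module.finrank_fintype_fun_eq_card] at hrn
  have hcompl := Fintype.card_subtype_compl fun i => hA.eigenvalues i = 0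
  have hle := Fintype.card_subtype_le fun i => hA.eigenvalues i = 0
  have hone : Fintype.card {i // hA.eigenvalues i = 0} = 1 := by
    change (G.lapMatrix ℝ).rank + 1 = _ at hrn
    simp only [ne_eq] at hrank
    omega
  obtain ⟨⟨j, hj⟩, huniq⟩ := Fintype.card_eq_one_iff.mp hone
  refine ⟨σ.symm j, by simpa [hσ] using hj, fun i hi => ?_⟩
  have := huniq ⟨σ i, by rw [← hσ, hi]⟩
  exact σ.eq_symm_apply.mpr (congrArg Subtype.val this)

theorem lapEigs_eq_zero_iff (hG : G.Connected) {i : Fin n} :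
    lapEigs G i = 0 ↔ (i : ℕ) = n - 1 := by
  obtain ⟨j, hj, huniq⟩ := existsUnique_lapEigs_eq_zero hG
  have hlast : lapEigs G ⟨n - 1, by have := j.pos; omega⟩ = 0 :=
    le_antisymm ((lapEigs_antitone G (Fin.mk_le_mk.mpr (by omega) : j ≤ _)).trans_eq hj)
      (lapEigs_nonneg G _)
  refine ⟨fun hi => ?_, fun hi => ?_⟩
  · rw [huniq i hi, ← huniq _ hlast]
  · rw [← hlast]
    congr 1
    exact Fin.ext hi

variable (G) {ι : Type*} [Fintype ι]

theorem exists_weights_lapEigs [DecidableRel G.Adj] {b : ι → Fin n → ℝ}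
    (hb : ∀ x, ∑ i, (b i ⬝ᵥ x) ^ 2 ≤ x ⬝ᵥ G.lapMatrix ℝ *ᵥ x) :
    ∃ t : Fin n → ℝ, (∀ j, 0 ≤ t j ∧ t j ≤ 1) ∧ ∑ j, t j ≤ Fintype.card ι ∧
      ∑ i, b i ⬝ᵥ b i = ∑ j, lapEigs G j * t j := by
  obtain ⟨σ, hσ⟩ := exists_perm_lapEigs G
  obtain ⟨t, ht, hsum, heq⟩ := (G.isHermitian_lapMatrix ℝ).exists_weights_of_sum_sq_le hb
  refine ⟨t ∘ σ, fun j => ht _, ?_, ?_⟩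
  · rwa [← Equiv.sum_comp σ] at hsum
  · rw [heq, ← Equiv.sum_comp σ]
    simp [hσ]

/-- If `b bᵀ` is dominated by the Laplacian, then its trace is at most the largest Laplacian
eigenvalue. -/
theorem dotProduct_self_le_lapEigs [DecidableRel G.Adj] (hn : 0 < n) {b : Fin n → ℝ}
    (hb : ∀ x, (b ⬝ᵥ x) ^ 2 ≤ x ⬝ᵥ G.lapMatrix ℝ *ᵥ x) :
    b ⬝ᵥ b ≤ lapEigs G ⟨0, hn⟩ := by
  obtain ⟨t, ht, hsum, heq⟩ := exists_weights_lapEigs G (b := fun _ : Unit => b) (by simpa using hb)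
  simp only [univ_unique, sum_singleton, Fintype.card_unit, Nat.cast_one] at heq hsum
  calc b ⬝ᵥ b = ∑ j, lapEigs G j * t j := heq
    _ ≤ ∑ j, lapEigs G ⟨0, hn⟩ * t j := sum_le_sum fun j _ =>
      mul_le_mul_of_nonneg_right (lapEigs_antitone G (Fin.mk_le_mk.mpr (Nat.zero_le _))) (ht j).1
    _ ≤ lapEigs G ⟨0, hn⟩ := by
      rw [← mul_sum]
      exact mul_le_of_le_one_right (lapEigs_nonneg G _) hsum

/-- If `b bᵀ + c cᵀ` is dominated by the Laplacian, then its trace is at most the sum of the two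
largest Laplacian eigenvalues. -/
theorem dotProduct_self_add_le_lapEigs [DecidableRel G.Adj] (hn : 1 < n) {b c : Fin n → ℝ}
    (hbc : ∀ x, (b ⬝ᵥ x) ^ 2 + (c ⬝ᵥ x) ^ 2 ≤ x ⬝ᵥ G.lapMatrix ℝ *ᵥ x) :
    b ⬝ᵥ b + c ⬝ᵥ c ≤ lapEigs G ⟨0, by omega⟩ + lapEigs G ⟨1, hn⟩ := by
  obtain ⟨t, ht, hsum, heq⟩ := exists_weights_lapEigs G (b := ![b, c]) (by simpa using hbc)
  simp only [Fin.sum_univ_two, Fintype.card_fin] at heq hsum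
  norm_num at hsum
  set μ₀ := lapEigs G ⟨0, by omega⟩
  set μ₁ := lapEigs G ⟨1, hn⟩
  have hμ : μ₁ ≤ μ₀ := lapEigs_antitone G (Fin.mk_le_mk.mpr (Nat.zero_le _))
  have hμ₁ : 0 ≤ μ₁ := lapEigs_nonneg G _
  calc b ⬝ᵥ b + c ⬝ᵥ c = ∑ j, lapEigs G j * t j := heq
    _ ≤ ∑ j, ((if j = ⟨0, by omega⟩ then μ₀ - μ₁ else 0) + μ₁ * t j) := sum_le_sum fun j _ => by
      split_ifs with hj
      · subst hj
        nlinarith [ht ⟨0, by omega⟩]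
      · have hj' : (⟨1, hn⟩ : Fin n) ≤ j := Fin.mk_le_mk.mpr
          (Nat.one_le_iff_ne_zero.mpr fun h => hj (Fin.ext h))
        rw [zero_add]
        exact mul_le_mul_of_nonneg_right (lapEigs_antitone G hj') (ht j).1
    _ ≤ μ₀ + μ₁ := by
      rw [sum_add_distrib, ← mul_sum, sum_ite_eq' univ]
      simp only [mem_univ, if_true]
      nlinarith

theorem degSeq_antitone : Antitone (degSeq G) := fun i j hij => by
  unfold degSeq
  exact Tuple.monotone_sort _ (Fin.rev_le_rev.mpr hij)

theorem exists_perm_degSeq [DecidableRel G.Adj] : ∃ σ : Equiv.Perm (Fin n),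
    ∀ i, degSeq G i = G.degree (σ i) := by
  have hrel : Classical.decRel G.Adj = ‹DecidableRel G.Adj› := Subsingleton.elim _ _
  refine ⟨Fin.revPerm.trans (Tuple.sort fun v => G.degree v), fun i => ?_⟩
  subst hrel
  rfl

end LaplacianSpectrum

theorem two_div_sub_div_sq_le_one_div {x y : ℝ} (hx : 0 < x) (hy : 0 < y) :
    2 / y - x / y ^ 2 ≤ 1 / x := by
  rw [← sub_nonneg]
  have h : 1 / x - (2 / y - x / y ^ 2) = (x - y) ^ 2 / (x * y ^ 2) := by
    field_simp
    ring
  rw [h]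
  positivity

/-- A lower bound for a sum of reciprocals with prescribed total, given lower bounds for one term
and for the sum of two terms. -/
theorem sum_one_div_ge_of_majorization {ι : Type*} [DecidableEq ι] {s : Finset ι} {μ : ι → ℝ}
    {i j : ι} {a b R : ℝ} (hi : i ∈ s) (hj : j ∈ s) (hij : i ≠ j) (hs : 2 < #s)
    (hμ : ∀ k ∈ s, 0 < μ k) (hb : 0 < b) (hba : b ≤ a) (hR : 0 < R)
    (hRb : R ≤ (#s - 2) * b) (hsum : ∑ k ∈ s, μ k = a + b + R)
    (h₁ : a ≤ μ i) (h₂ : a + b ≤ μ i + μ j) :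
    1 / a + 1 / b + (#s - 2) ^ 2 / R ≤ ∑ k ∈ s, 1 / μ k := by
  have ha : 0 < a := hb.trans_le hba
  have hs' : (0 : ℝ) < #s - 2 := sub_pos.mpr (by exact_mod_cast hs)
  have hjs : j ∈ s.erase i := mem_erase.mpr ⟨hij.symm, hj⟩
  have hcard : (#((s.erase i).erase j) : ℝ) = #s - 2 := by
    rw [card_erase_of_mem hjs, card_erase_of_mem hi, Nat.sub_sub, Nat.cast_sub (by omega)]
    norm_num
  rw [← add_sum_erase s _ hi, ← add_sum_erase _ _ hjs] at hsum ⊢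
  set N : ℝ := #s - 2
  set c := R / N with hc
  have hcpos : 0 < c := div_pos hR hs'
  have hcb : c ≤ b := (div_le_iff₀ hs').mpr (by linarith)
  have hRc : R = N * c := by rw [hc]; field_simp
  have hrest : N * (2 / c) - (∑ k ∈ (s.erase i).erase j, μ k) / c ^ 2 ≤
      ∑ k ∈ (s.erase i).erase j, 1 / μ k := by
    rw [← hcard, ← nsmul_eq_mul, ← sum_const, sum_div, ← sum_sub_distrib]
    exact sum_le_sum fun k hk => two_div_sub_div_sq_le_one_div
      (hμ k (mem_of_mem_erase (mem_of_mem_erase hk))) hcpos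
  have hmi := two_div_sub_div_sq_le_one_div (hμ i hi) ha
  have hmj := two_div_sub_div_sq_le_one_div (hμ j hj) hb
  have hrw : N ^ 2 / R = N / c := by rw [hRc]; field_simp
  have hS : ∑ k ∈ (s.erase i).erase j, μ k = a + b + N * c - μ i - μ j := by linarith
  rw [hS] at hrest
  have hab : 0 ≤ 1 / b ^ 2 - 1 / a ^ 2 := sub_nonneg.mpr (by gcongr)
  have hbc : 0 ≤ 1 / c ^ 2 - 1 / b ^ 2 := sub_nonneg.mpr (by gcongr)
  have hkey : 2 / a - μ i / a ^ 2 + (2 / b - μ j / b ^ 2) +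
      (N * (2 / c) - (a + b + N * c - μ i - μ j) / c ^ 2) - (1 / a + 1 / b + N / c) =
      (1 / b ^ 2 - 1 / a ^ 2) * (μ i - a) + (1 / c ^ 2 - 1 / b ^ 2) * (μ i + μ j - (a + b)) := by
    field_simp
    ring
  have := mul_nonneg hab (sub_nonneg.mpr h₁)
  have := mul_nonneg hbc (sub_nonneg.mpr h₂)
  rw [hrw]
  linarith

/-- For a simple connected graph `G` on `n ≥ 4` vertices with `m` edges,
largest degree `d₁` and second largest degree `d₂ ≥ 1`, and `G'` obtained from `G` by
adding `h` new edges with `1 ≤ h ≤ n(n−1)/2 − m`, if `2m + 2h ≤ 1 + d₁ + (n−2)d₂` then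
`K(G') ≥ n (1/(d₁+1) + 1/d₂ + (n−3)²/(2m+2h−1−d₁−d₂))`. -/
theorem kirchhoff_lower_bound_add_links {n m h d₁ d₂ : ℕ}
    (hn : 4 ≤ n)
    (G G' : SimpleGraph (Fin n))
    (hconn : G.Connected)
    (hm : G.edgeSet.ncard = m)
    (hd₁ : d₁ = degSeq G ⟨0, by omega⟩)
    (hd₂ : d₂ = degSeq G ⟨1, by omega⟩)
    (hd₂pos : 1 ≤ d₂)
    (hsub : G ≤ G')
    (hm' : G'.edgeSet.ncard = m + h)
    (hh₁ : 1 ≤ h)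
    (hh₂ : h ≤ n * (n - 1) / 2 - m)
    (hass : 2 * m + 2 * h ≤ 1 + d₁ + (n - 2) * d₂) :
    (n : ℝ) * (1 / ((d₁ : ℝ) + 1) + 1 / (d₂ : ℝ) +
        ((n : ℝ) - 3) ^ 2 / (2 * (m : ℝ) + 2 * (h : ℝ) - 1 - (d₁ : ℝ) - (d₂ : ℝ)))
      ≤ kirchhoffIndex G' := by
  classical
  obtain ⟨σ, hσ⟩ := exists_perm_degSeq G
  set u := σ ⟨0, by omega⟩
  set v := σ ⟨1, by omega⟩
  have huv : u ≠ v := fun h => by simpa using σ.injective h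
  rw [hσ] at hd₁ hd₂
  have hd : d₂ ≤ d₁ := by
    rw [hd₁, hd₂, ← hσ, ← hσ]
    exact degSeq_antitone G (Fin.mk_le_mk.mpr (Nat.zero_le _))
  have hdegpos : ∀ w, 1 ≤ G.degree w := fun w => by
    have : Nontrivial (Fin n) := Fin.nontrivial_iff_two_le.mpr (by omega)
    exact hconn.preconnected.degree_pos_of_nontrivial w
  have hm₂ : d₁ + d₂ + (n - 2) ≤ 2 * m := by
    have hsum := G.sum_degrees_eq_twice_card_edges
    rw [← Set.ncard_coe_finset, SimpleGraph.coe_edgeFinset, hm, ← add_sum_erase univ _ (mem_univ u),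
      ← add_sum_erase _ _ (mem_erase.mpr ⟨huv.symm, mem_univ v⟩), ← hd₁, ← hd₂] at hsum
    have hrest := card_nsmul_le_sum ((univ.erase u).erase v) (fun w => G.degree w) 1
      fun w _ => hdegpos w
    rw [card_erase_of_mem (mem_erase.mpr ⟨huv.symm, mem_univ v⟩), card_erase_of_mem (mem_univ u),
      card_univ, Fintype.card_fin, smul_eq_mul] at hrest
    omega
  have hd₁two : 2 ≤ d₁ := by
    by_contra! hlt
    have : d₂ = 1 := by omega
    subst this
    omega
  have hadj : ∀ w x, x ∈ G.neighborFinset w → G'.Adj w x := fun w x hx =>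
    hsub ((G.mem_neighborFinset w x).mp hx)
  have hnotmem : ∀ w, w ∉ G.neighborFinset w := fun w => G.notMem_neighborFinset_self w
  have hne : ∀ w, (G.neighborFinset w).Nonempty := fun w =>
    card_pos.mp ((hdegpos w).trans_eq (G.card_neighborFinset_eq_degree w).symm)
  have hμ₁ : (d₁ : ℝ) + 1 ≤ lapEigs G' ⟨0, by omega⟩ := by
    have h := dotProduct_self_le_lapEigs G' (by omega)
      (G'.starVec_sq_le_lapMatrix (hadj u))
    rwa [SimpleGraph.starVec_dotProduct_self (hnotmem u) (hne u),
      G.card_neighborFinset_eq_degree, ← hd₁] at h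
  have hμ₂ : (d₁ : ℝ) + 1 + d₂ ≤ lapEigs G' ⟨0, by omega⟩ + lapEigs G' ⟨1, by omega⟩ := by
    have hcard : d₁ ≤ #((G.neighborFinset u).erase v) + 1 := by
      have hu := (G.card_neighborFinset_eq_degree u).trans hd₁.symm
      have := pred_card_le_card_erase (s := G.neighborFinset u) (a := v)
      omega
    have h := dotProduct_self_add_le_lapEigs G' (by omega)
      (G'.starVec_add_sq_le_lapMatrix huv (notMem_erase v (G.neighborFinset u))
        (fun w hw => hadj u w (mem_of_mem_erase hw)) (hadj v))
    rw [SimpleGraph.starVec_dotProduct_self (hnotmem v) (hne v),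
      SimpleGraph.starVec_dotProduct_self (fun h => hnotmem u (mem_of_mem_erase h))
        (card_pos.mp (by omega)), G.card_neighborFinset_eq_degree, ← hd₂] at h
    have hcard' : (d₁ : ℝ) ≤ #((G.neighborFinset u).erase v) + 1 := by exact_mod_cast hcard
    linarith
  have hzero : ∀ i : Fin n, lapEigs G' i = 0 ↔ (i : ℕ) = n - 1 := fun _ =>
    lapEigs_eq_zero_iff (hconn.mono hsub)
  set s := univ.filter fun i : Fin n => (i : ℕ) < n - 1 with hs
  have hscard : #s = n - 1 := by
    rw [hs, Fin.card_filter_val_lt]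
    omega
  have hsum : ∑ i ∈ s, lapEigs G' i = 2 * ((m : ℝ) + h) := by
    have htot := sum_lapEigs G'
    rw [hm', Nat.cast_add] at htot
    rw [← htot]
    refine sum_subset (subset_univ s) fun i _ hi => (hzero i).mpr ?_
    simp only [hs, mem_filter, mem_univ, true_and] at hi
    omega
  have hn' : (#s : ℝ) - 2 = n - 3 := by
    rw [hscard, Nat.cast_sub (by omega)]
    push_cast
    ring
  have hass' : 2 * (m : ℝ) + 2 * h ≤ 1 + d₁ + (n - 2) * d₂ := by
    have := (Nat.cast_le (α := ℝ)).mpr hass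
    push_cast [Nat.cast_sub (show 2 ≤ n by omega)] at this
    exact this
  have hm₂' : (d₁ : ℝ) + d₂ + 2 ≤ 2 * m := by exact_mod_cast (by omega : d₁ + d₂ + 2 ≤ 2 * m)
  have hh₁' : (1 : ℝ) ≤ h := by exact_mod_cast hh₁
  have hd' : (d₂ : ℝ) ≤ d₁ := by exact_mod_cast hd
  have key := sum_one_div_ge_of_majorization (s := s) (μ := lapEigs G') (i := ⟨0, by omega⟩)
    (j := ⟨1, by omega⟩) (a := (d₁ : ℝ) + 1) (b := d₂)
    (R := 2 * (m : ℝ) + 2 * (h : ℝ) - 1 - (d₁ : ℝ) - (d₂ : ℝ))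
    (by simp [hs]; omega) (by simp [hs]; omega) (by simp) (by omega)
    (fun k hk => (lapEigs_nonneg G' k).lt_of_ne' fun h0 => by
      simp only [hs, mem_filter, mem_univ, true_and] at hk
      have := (hzero k).mp h0
      omega)
    (by exact_mod_cast hd₂pos) (by linarith) (by linarith) (by rw [hn']; linarith)
    (by rw [hsum]; ring) hμ₁ hμ₂
  rw [hn'] at key
  exact mul_le_mul_of_nonneg_left key (Nat.cast_nonneg n)
end

section
/- Let a > 0, 1 ≤ h ≤ n, and 0 < α ≤ a/h, and consider the set S₂^[h] = { x ∈ ℝⁿ : x₁ ≥ x₂ ≥ … ≥ xₙ ≥ 0, Σ_{i=1}^n xᵢ = a, xᵢ ≥ α for i = 1, …, h }. If α ≤ a/n, then the constant vector (a/n, …, a/n) belongs to S₂^[h] and is its minimal element with respect to the majorization order. If α > a/n (and h < n), then the vector whose first h coordinates equal α and whose remaining n − h coordinates equal ρ = (a − αh)/(n − h) belongs to S₂^[h] and is its minimal element with respect to the majorization order. -/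
open Finset

/-- A vector that is constant `c` on the indices below `h` and constant `r` from `h` on is majorized
by every non-increasing vector with the same sum that is at least `c` below `h`. -/
theorem majorizedBy_ite_of_antitone {n : ℕ} {x : Fin n → ℝ} (hx : Antitone x) (h : ℕ) (c r : ℝ)
    (hc : ∀ i : Fin n, (i : ℕ) < h → c ≤ x i)
    (hsum : ∑ i : Fin n, (if (i : ℕ) < h then c else r) = ∑ i, x i) :
    MajorizedBy (fun i : Fin n => if (i : ℕ) < h then c else r) x := by
  refine ⟨fun k hk => ?_, hsum⟩
  by_cases htail : h ≤ k ∧ x ⟨k, hk⟩ ≤ r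
  · have hle : ∑ i ∈ univ.filter (fun i : Fin n => ¬ (i : ℕ) < k), x i ≤
        ∑ i ∈ univ.filter (fun i : Fin n => ¬ (i : ℕ) < k), (if (i : ℕ) < h then c else r) := by
      refine sum_le_sum fun i hi => ?_
      have hki : k ≤ (i : ℕ) := not_lt.1 (mem_filter.1 hi).2
      rw [if_neg (by omega)]
      exact (hx (show (⟨k, hk⟩ : Fin n) ≤ i from hki)).trans htail.2
    rw [← sum_filter_add_sum_filter_not univ (fun i : Fin n => (i : ℕ) < k),
      ← sum_filter_add_sum_filter_not univ (fun i : Fin n => (i : ℕ) < k) x] at hsum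
    linarith
  · refine sum_le_sum fun i hi => ?_
    have hik : (i : ℕ) < k := (mem_filter.1 hi).2
    split_ifs with hih
    · exact hc i hih
    · have hr : r < x ⟨k, hk⟩ := lt_of_not_ge fun hr => htail ⟨by omega, hr⟩
      exact hr.le.trans (hx (show i ≤ (⟨k, hk⟩ : Fin n) from hik.le))

theorem sum_ite_val_lt {n h : ℕ} (hn : h ≤ n) (c r : ℝ) :
    ∑ i : Fin n, (if (i : ℕ) < h then c else r) = h * c + (n - h) * r := by
  rw [Fin.sum_univ_eq_sum_range (fun i => if i < h then c else r),
    ← sum_range_add_sum_Ico _ hn,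
    sum_congr rfl (fun i hi => if_pos (mem_range.1 hi)),
    sum_congr rfl (fun i hi => if_neg (not_lt.2 (mem_Ico.1 hi).1))]
  simp [Nat.cast_sub hn]

/-- Corollary 14 of Bianchi–Cornaro–Torriero. For
`S₂^[h] = {x : x₁ ≥ … ≥ xₙ ≥ 0, Σ xᵢ = a, xᵢ ≥ α for i = 1, …, h}` with `a > 0`,
`1 ≤ h ≤ n` and `0 < α ≤ a/h`: if `α ≤ a/n` the constant vector `a/n` is the minimal
element of `S₂^[h]` w.r.t. majorization; if `α > a/n` (and `h < n`) the minimal element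
is the vector with first `h` coordinates `α` and remaining coordinates
`ρ = (a − αh)/(n − h)`. -/
theorem minimal_element_S2 {n : ℕ} (a : ℝ) (ha : 0 < a)
    (h : ℕ) (hh₁ : 1 ≤ h) (hh₂ : h ≤ n)
    (α : ℝ) (hα : 0 < α) (hαh : α ≤ a / (h : ℝ)) :
    (α ≤ a / (n : ℝ) →
      ((fun _ : Fin n => a / (n : ℝ)) ∈
          {x : Fin n → ℝ | Antitone x ∧ (∀ i, 0 ≤ x i) ∧ (∑ i, x i) = a ∧
            ∀ i : Fin n, (i : ℕ) < h → α ≤ x i} ∧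
        ∀ x ∈ {x : Fin n → ℝ | Antitone x ∧ (∀ i, 0 ≤ x i) ∧ (∑ i, x i) = a ∧
            ∀ i : Fin n, (i : ℕ) < h → α ≤ x i},
          MajorizedBy (fun _ : Fin n => a / (n : ℝ)) x)) ∧
    (a / (n : ℝ) < α → h < n →
      ((fun i : Fin n => if (i : ℕ) < h then α else (a - α * (h : ℝ)) / ((n : ℝ) - (h : ℝ))) ∈
          {x : Fin n → ℝ | Antitone x ∧ (∀ i, 0 ≤ x i) ∧ (∑ i, x i) = a ∧
            ∀ i : Fin n, (i : ℕ) < h → α ≤ x i} ∧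
        ∀ x ∈ {x : Fin n → ℝ | Antitone x ∧ (∀ i, 0 ≤ x i) ∧ (∑ i, x i) = a ∧
            ∀ i : Fin n, (i : ℕ) < h → α ≤ x i},
          MajorizedBy
            (fun i : Fin n => if (i : ℕ) < h then α else (a - α * (h : ℝ)) / ((n : ℝ) - (h : ℝ)))
            x)) := by
  have hn : (0 : ℝ) < n := by exact_mod_cast (by omega : 0 < n)
  have hh : (0 : ℝ) < h := by exact_mod_cast hh₁
  constructor
  · intro hαn
    have hsum : ∑ _i : Fin n, a / (n : ℝ) = a := by
      simp [mul_div_cancel₀ a hn.ne']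
    refine ⟨⟨antitone_const, fun _ => by positivity, hsum, fun _ _ => hαn⟩, ?_⟩
    rintro x ⟨hx, -, hxa, -⟩
    simpa using majorizedBy_ite_of_antitone hx 0 0 (a / n) (by simp) (by simpa [hxa] using hsum)
  · intro hnα hlt
    have hd : (0 : ℝ) < n - h := sub_pos.2 (by exact_mod_cast hlt)
    rw [le_div_iff₀ hh] at hαh
    rw [div_lt_iff₀ hn] at hnα
    have hρ₀ : 0 ≤ (a - α * h) / ((n : ℝ) - h) := div_nonneg (by linarith) hd.le
    have hρα : (a - α * h) / ((n : ℝ) - h) ≤ α := by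
      rw [div_le_iff₀ hd]
      linarith
    have hsum : ∑ i : Fin n, (if (i : ℕ) < h then α else (a - α * h) / ((n : ℝ) - h)) = a := by
      rw [sum_ite_val_lt hh₂, mul_div_cancel₀ _ hd.ne']
      ring
    refine ⟨⟨fun i j hij => ?_, fun i => ?_, hsum, fun i hi => (if_pos hi).ge⟩, ?_⟩
    · have hij' : (i : ℕ) ≤ j := hij
      dsimp only
      split_ifs
      · exact le_rfl
      · omega
      · exact hρα
      · exact le_rfl
    · dsimp only
      split_ifs
      · exact hα.le
      · exact hρ₀
    · rintro x ⟨hx, -, hxa, hxα⟩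
      exact majorizedBy_ite_of_antitone hx h α _ hxα (hsum.trans hxa.symm)
end

section
/- Let G be a simple graph on n vertices with at least one edge, with largest degree d₁ and second largest degree d₂, and let G′ be a simple graph on the same vertex set obtained from G by adding h ≥ 1 new edges. Then the two largest Laplacian eigenvalues of G′ satisfy μ₁(G′) ≥ 1 + d₁ and μ₂(G′) ≥ d₂. -/
open Finset

theorem Tuple.le_sort_rev_zero {n : ℕ} {α : Type*} [LinearOrder α] (f : Fin n → α) (hn : 0 < n)
    (i : Fin n) : f i ≤ (f ∘ Tuple.sort f) (Fin.rev ⟨0, hn⟩) := by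
  obtain ⟨j, rfl⟩ := (Tuple.sort f).surjective i
  refine Tuple.monotone_sort f ?_
  rw [Fin.le_def, Fin.val_rev]
  have := j.isLt
  simp only
  omega

theorem Tuple.le_sort_rev_one {n : ℕ} {α : Type*} [LinearOrder α] (f : Fin n → α) (hn : 1 < n)
    {c : α} (h : ∀ i₀, ∃ i, i ≠ i₀ ∧ c ≤ f i) :
    c ≤ (f ∘ Tuple.sort f) (Fin.rev ⟨1, hn⟩) := by
  obtain ⟨i, hi, hc⟩ := h (Tuple.sort f (Fin.rev ⟨0, by omega⟩))
  obtain ⟨j, rfl⟩ := (Tuple.sort f).surjective i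
  refine hc.trans (Tuple.monotone_sort f ?_)
  have hj : (j : ℕ) ≠ n - 1 := by
    rintro h
    exact hi (congrArg _ (Fin.ext (by rw [Fin.val_rev]; simpa using h)))
  rw [Fin.le_def, Fin.val_rev]
  have := j.isLt
  simp only
  omega

section Rayleigh

open Matrix

variable {ι : Type*} [Fintype ι] [DecidableEq ι] {A : Matrix ι ι ℝ}

/-- A nonzero vector whose Rayleigh quotient is at least `c` is not orthogonal to all
eigenvectors with eigenvalue at least `c`. -/
theorem Matrix.IsHermitian.exists_le_eigenvalues (hA : A.IsHermitian) {c : ℝ} {f : ι → ℝ}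
    (hf : f ≠ 0) (h : c * (f ⬝ᵥ f) ≤ f ⬝ᵥ A *ᵥ f) :
    ∃ i, f ⬝ᵥ (hA.eigenvectorBasis i).ofLp ≠ 0 ∧ c ≤ hA.eigenvalues i := by
  by_contra! hcon
  set v : ι → ι → ℝ := fun i => (hA.eigenvectorBasis i).ofLp with hv
  have key : ∀ g : ι → ℝ, ∑ i, (f ⬝ᵥ v i) * (v i ⬝ᵥ g) = f ⬝ᵥ g := by
    intro g
    have := hA.eigenvectorBasis.sum_inner_mul_inner (WithLp.toLp 2 f) (WithLp.toLp 2 g)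
    simpa [EuclideanSpace.inner_eq_star_dotProduct, dotProduct_comm, hv] using this
  have hAv : ∀ i, v i ⬝ᵥ A *ᵥ f = hA.eigenvalues i * (f ⬝ᵥ v i) := by
    intro i
    have hT : Aᵀ = A := by simpa [conjTranspose_eq_transpose_of_trivial] using hA.eq
    rw [dotProduct_mulVec, ← mulVec_transpose, hT, hv]
    simp only
    rw [hA.mulVec_eigenvectorBasis, smul_dotProduct, smul_eq_mul, dotProduct_comm]
  have h1 := key f
  have h2 := key (A *ᵥ f)
  simp only [hAv] at h2
  rw [← h1, ← h2, Finset.mul_sum] at h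
  have hle : ∀ i ∈ Finset.univ, (f ⬝ᵥ v i) * (hA.eigenvalues i * (f ⬝ᵥ v i)) ≤
      c * ((f ⬝ᵥ v i) * (v i ⬝ᵥ f)) := by
    intro i _
    rw [dotProduct_comm (v i) f]
    by_cases h0 : f ⬝ᵥ v i = 0
    · simp [h0]
    · nlinarith [hcon i h0, mul_self_nonneg (f ⬝ᵥ v i)]
  have heq := (Finset.sum_eq_sum_iff_of_le hle).1 (le_antisymm (Finset.sum_le_sum hle) h)
  have hzero : ∀ i, f ⬝ᵥ v i = 0 := by
    intro i
    by_contra h0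
    have h3 := heq i (Finset.mem_univ i)
    rw [dotProduct_comm (v i) f] at h3
    nlinarith [hcon i h0, mul_self_pos.2 h0]
  exact hf (dotProduct_self_eq_zero.1 (by rw [← h1]; simp [hzero]))

/-- If the Rayleigh quotient is at least `c` on a plane, at least two eigenvalues are at
least `c`. -/
theorem Matrix.IsHermitian.exists_ne_le_eigenvalues (hA : A.IsHermitian) {c : ℝ}
    {g₁ g₂ : ι → ℝ} (hg : ∀ x y : ℝ, x • g₁ + y • g₂ = 0 → x = 0 ∧ y = 0)
    (h : ∀ x y : ℝ, c * ((x • g₁ + y • g₂) ⬝ᵥ (x • g₁ + y • g₂)) ≤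
      (x • g₁ + y • g₂) ⬝ᵥ A *ᵥ (x • g₁ + y • g₂)) (i₀ : ι) :
    ∃ i, i ≠ i₀ ∧ c ≤ hA.eigenvalues i := by
  set w := (hA.eigenvectorBasis i₀).ofLp with hw
  obtain ⟨x, y, hxy, hort⟩ : ∃ x y : ℝ, ¬ (x = 0 ∧ y = 0) ∧ (x • g₁ + y • g₂) ⬝ᵥ w = 0 := by
    by_cases h0 : g₁ ⬝ᵥ w = 0
    · exact ⟨1, 0, by simp, by simp [h0]⟩
    · refine ⟨g₂ ⬝ᵥ w, - (g₁ ⬝ᵥ w), by simp [h0], ?_⟩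
      simp only [add_dotProduct, smul_dotProduct, smul_eq_mul]
      ring
  obtain ⟨i, hi, hc⟩ := hA.exists_le_eigenvalues (fun h0 => hxy (hg x y h0)) (h x y)
  exact ⟨i, fun h0 => hi (by rw [h0]; exact hort), hc⟩

end Rayleigh

namespace SimpleGraph

open Matrix

variable {V : Type*} [Fintype V] [DecidableEq V] (G : SimpleGraph V) [DecidableRel G.Adj]

theorem dotProduct_lapMatrix_mulVec (f : V → ℝ) :
    f ⬝ᵥ G.lapMatrix ℝ *ᵥ f = (∑ i, ∑ j, if G.Adj i j then (f i - f j) ^ 2 else 0) / 2 := by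
  rw [← G.lapMatrix_toLinearMap₂' ℝ f, Matrix.toLinearMap₂'_apply']

theorem sum_le_dotProduct_lapMatrix_mulVec (f : V → ℝ) (u : V) :
    ∑ w ∈ Finset.univ.erase u, (if G.Adj u w then (f u - f w) ^ 2 else 0) ≤
      f ⬝ᵥ G.lapMatrix ℝ *ᵥ f := by
  rw [dotProduct_lapMatrix_mulVec, le_div_iff₀ two_pos,
    ← Finset.add_sum_erase _ _ (Finset.mem_univ u), ← Finset.add_sum_erase (a := u) Finset.univ
      (fun j => if G.Adj u j then (f u - f j) ^ 2 else 0) (Finset.mem_univ u)]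
  have : ∑ w ∈ Finset.univ.erase u, (if G.Adj u w then (f u - f w) ^ 2 else 0) ≤
      ∑ i ∈ Finset.univ.erase u, ∑ j, if G.Adj i j then (f i - f j) ^ 2 else 0 := by
    refine Finset.sum_le_sum fun i _ => ?_
    refine le_trans (le_of_eq ?_) (Finset.single_le_sum (f := fun j =>
      if G.Adj i j then (f i - f j) ^ 2 else 0) (fun j _ => by positivity) (Finset.mem_univ u))
    simp only [G.adj_comm i u, sub_sq_comm (f i)]
  simp only [SimpleGraph.irrefl, if_false]
  linarith

theorem add_sum_le_dotProduct_lapMatrix_mulVec (f : V → ℝ) {u v : V} (huv : u ≠ v) :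
    (if G.Adj u v then (f u - f v) ^ 2 else 0) + ∑ w ∈ (Finset.univ.erase u).erase v,
      ((if G.Adj u w then (f u - f w) ^ 2 else 0) + if G.Adj v w then (f v - f w) ^ 2 else 0) ≤
      f ⬝ᵥ G.lapMatrix ℝ *ᵥ f := by
  have hv : v ∈ Finset.univ.erase u := Finset.mem_erase.2 ⟨huv.symm, Finset.mem_univ v⟩
  have hsplit : ∀ F : V → ℝ, ∑ w, F w = F u + F v + ∑ w ∈ (Finset.univ.erase u).erase v, F w := by
    intro F
    rw [add_assoc, Finset.add_sum_erase _ _ hv, Finset.add_sum_erase _ _ (Finset.mem_univ u)]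
  have : ∑ w ∈ (Finset.univ.erase u).erase v,
      ((if G.Adj u w then (f u - f w) ^ 2 else 0) + if G.Adj v w then (f v - f w) ^ 2 else 0) ≤
      ∑ i ∈ (Finset.univ.erase u).erase v, ∑ j, if G.Adj i j then (f i - f j) ^ 2 else 0 := by
    refine Finset.sum_le_sum fun i _ => ?_
    rw [hsplit]
    simp only [G.adj_comm i u, G.adj_comm i v, sub_sq_comm (f i) (f u), sub_sq_comm (f i) (f v)]
    exact le_add_of_nonneg_right (Finset.sum_nonneg fun j _ => by positivity)
  rw [dotProduct_lapMatrix_mulVec, le_div_iff₀ two_pos, hsplit,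
    hsplit (fun j => if G.Adj u j then (f u - f j) ^ 2 else 0),
    hsplit (fun j => if G.Adj v j then (f v - f j) ^ 2 else 0)]
  rw [Finset.sum_add_distrib] at this ⊢
  simp only [SimpleGraph.irrefl, if_false, G.adj_comm v u, sub_sq_comm (f v) (f u)]
  linarith

theorem sum_erase_ite_adj (u : V) :
    ∑ w ∈ Finset.univ.erase u, (if G.Adj u w then (1 : ℝ) else 0) = G.degree u := by
  rw [G.degree_eq_sum_if_adj (R := ℝ) u, ← Finset.add_sum_erase _ _ (Finset.mem_univ u)]
  simp

theorem ite_adj_add_sum_erase_ite_adj {u v : V} (huv : u ≠ v) :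
    (if G.Adj u v then (1 : ℝ) else 0) +
      ∑ w ∈ (Finset.univ.erase u).erase v, (if G.Adj u w then (1 : ℝ) else 0) = G.degree u := by
  rw [← sum_erase_ite_adj, Finset.add_sum_erase (a := v) (Finset.univ.erase u)
    (fun w => if G.Adj u w then (1 : ℝ) else 0)
    (Finset.mem_erase.2 ⟨huv.symm, Finset.mem_univ v⟩)]

theorem exists_degree_add_one_le_eigenvalues (hL : (G.lapMatrix ℝ).IsHermitian) {u : V}
    (hu : 0 < G.degree u) : ∃ i, 1 + (G.degree u : ℝ) ≤ hL.eigenvalues i := by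
  set d : ℝ := (G.degree u : ℝ) with hd
  have hd0 : 0 < d := by rw [hd]; exact_mod_cast hu
  set f : V → ℝ := fun w => if w = u then d else if G.Adj u w then -1 else 0 with hf
  have hfu : f u = d := by simp [hf]
  have hfw : ∀ w ∈ Finset.univ.erase u, f w = if G.Adj u w then -1 else 0 := by
    intro w hw
    simp [hf, Finset.ne_of_mem_erase hw]
  have hsum := G.sum_erase_ite_adj u
  rw [← hd] at hsum
  obtain ⟨i, -, hi⟩ := hL.exists_le_eigenvalues (c := 1 + d) (f := f)
    (fun h0 => hd0.ne' (by rw [← hfu, h0]; rfl)) (by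
      refine le_trans (le_of_eq ?_) (G.sum_le_dotProduct_lapMatrix_mulVec f u)
      have h1 : f ⬝ᵥ f = d * d + d := by
        rw [dotProduct, ← Finset.add_sum_erase _ _ (Finset.mem_univ u), hfu, ← hsum]
        congr 1
        refine Finset.sum_congr rfl fun w hw => ?_
        rw [hfw w hw]
        split_ifs <;> norm_num
      have h2 : ∑ w ∈ Finset.univ.erase u, (if G.Adj u w then (f u - f w) ^ 2 else 0) =
          (d + 1) ^ 2 * ∑ w ∈ Finset.univ.erase u, (if G.Adj u w then 1 else 0) := by
        rw [Finset.mul_sum]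
        refine Finset.sum_congr rfl fun w hw => ?_
        rw [hfw w hw, hfu]
        split_ifs <;> ring
      rw [h1, h2, hsum]
      ring)
  exact ⟨i, hi⟩

theorem exists_ne_le_eigenvalues_of_not_adj (hL : (G.lapMatrix ℝ).IsHermitian) {u v : V} {b : ℝ}
    (huv : u ≠ v) (hadj : ¬ G.Adj u v) (hu : b ≤ G.degree u) (hv : b ≤ G.degree v) (i₀ : V) :
    ∃ i, i ≠ i₀ ∧ b ≤ hL.eigenvalues i := by
  have hsu := G.ite_adj_add_sum_erase_ite_adj huv
  have hsv := G.ite_adj_add_sum_erase_ite_adj huv.symm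
  rw [if_neg hadj, zero_add] at hsu
  rw [if_neg (fun h => hadj h.symm), zero_add, Finset.erase_right_comm] at hsv
  refine hL.exists_ne_le_eigenvalues (g₁ := Pi.single u 1) (g₂ := Pi.single v 1) ?_ ?_ i₀
  · intro x y h
    exact ⟨by simpa [huv] using congrFun h u, by simpa [huv.symm] using congrFun h v⟩
  · intro x y
    set f : V → ℝ := x • Pi.single u 1 + y • Pi.single v 1 with hf
    have hfu : f u = x := by simp [hf, huv]
    have hfv : f v = y := by simp [hf, huv.symm]
    have hff : f ⬝ᵥ f = x ^ 2 + y ^ 2 := by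
      conv_lhs => rw [hf]
      simp [huv, huv.symm]
      ring
    refine le_trans ?_ (G.add_sum_le_dotProduct_lapMatrix_mulVec f huv)
    have : ∑ w ∈ (Finset.univ.erase u).erase v, ((if G.Adj u w then (f u - f w) ^ 2 else 0) +
        if G.Adj v w then (f v - f w) ^ 2 else 0) = x ^ 2 * G.degree u + y ^ 2 * G.degree v := by
      rw [← hsu, ← hsv, Finset.mul_sum, Finset.mul_sum, ← Finset.sum_add_distrib]
      refine Finset.sum_congr rfl fun w hw => ?_
      simp only [Finset.mem_erase] at hw
      have hfw : f w = 0 := by simp [hf, hw.1, hw.2.1]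
      simp [hfu, hfv, hfw]
    rw [if_neg hadj, zero_add, this, hff]
    nlinarith [sq_nonneg x, sq_nonneg y]

theorem exists_ne_le_eigenvalues_of_adj (hL : (G.lapMatrix ℝ).IsHermitian) {u v : V} {k : ℝ}
    (hk : 0 < k) (hadj : G.Adj u v) (hu : k + 1 ≤ G.degree u) (hv : k + 1 ≤ G.degree v) (i₀ : V) :
    ∃ i, i ≠ i₀ ∧ k + 1 ≤ hL.eigenvalues i := by
  have huv := hadj.ne
  have hsu := G.ite_adj_add_sum_erase_ite_adj huv
  have hsv := G.ite_adj_add_sum_erase_ite_adj huv.symm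
  rw [if_pos hadj] at hsu
  rw [if_pos hadj.symm, Finset.erase_right_comm] at hsv
  set S := (Finset.univ.erase u).erase v with hS
  set α : V → ℝ := fun w => if G.Adj u w then 1 else 0 with hα
  set β : V → ℝ := fun w => if G.Adj v w then 1 else 0 with hβ
  set g₁ : V → ℝ := fun w => if w = u then k else if w = v then 0 else - α w with hg₁
  set g₂ : V → ℝ := fun w => if w = u then 0 else if w = v then k else - β w with hg₂
  have hfu : ∀ x y : ℝ, (x • g₁ + y • g₂) u = x * k := fun x y => by simp [hg₁, hg₂]
  have hfv : ∀ x y : ℝ, (x • g₁ + y • g₂) v = y * k := fun x y => by simp [hg₁, hg₂, huv.symm]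
  refine hL.exists_ne_le_eigenvalues (g₁ := g₁) (g₂ := g₂) ?_ ?_ i₀
  · intro x y h
    have h1 := hfu x y
    have h2 := hfv x y
    rw [h] at h1 h2
    exact ⟨by simpa [hk.ne'] using h1.symm, by simpa [hk.ne'] using h2.symm⟩
  · intro x y
    set f : V → ℝ := x • g₁ + y • g₂ with hf
    replace hfu : f u = x * k := hfu x y
    replace hfv : f v = y * k := hfv x y
    have hfw : ∀ w ∈ S, f w = - (x * α w + y * β w) := by
      intro w hw
      simp only [hS, Finset.mem_erase] at hw
      simp only [hf, hg₁, hg₂, Pi.add_apply, Pi.smul_apply, smul_eq_mul, if_neg hw.1, if_neg hw.2.1]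
      ring
    refine le_trans ?_ (G.add_sum_le_dotProduct_lapMatrix_mulVec f huv)
    have hff : f ⬝ᵥ f = (x * k) ^ 2 + (y * k) ^ 2 + ∑ w ∈ S, f w ^ 2 := by
      rw [dotProduct, ← Finset.add_sum_erase _ _ (Finset.mem_univ u),
        ← Finset.add_sum_erase (a := v) (Finset.univ.erase u) _
          (Finset.mem_erase.2 ⟨huv.symm, Finset.mem_univ v⟩), hfu, hfv, ← hS]
      simp only [sq]
      ring
    -- `m = k` works if `0 ≤ x * y`, and `m = 0` works otherwise
    obtain ⟨m, hm0, hm, hmw⟩ : ∃ m : ℝ, 0 ≤ m ∧ 2 * k * (x * y) ≤ m * (x ^ 2 + y ^ 2) ∧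
        ∀ w ∈ S, (k ^ 2 + m) * x ^ 2 * α w + (k ^ 2 + m) * y ^ 2 * β w + (k + 1) * f w ^ 2 ≤
          (if G.Adj u w then (f u - f w) ^ 2 else 0) +
            if G.Adj v w then (f v - f w) ^ 2 else 0 := by
      rcases le_total 0 (x * y) with hxy | hxy
      · refine ⟨k, hk.le, by nlinarith [mul_nonneg hk.le (sq_nonneg (x - y))], fun w hw => ?_⟩
        rw [hfw w hw, hfu, hfv]
        simp only [hα, hβ]
        split_ifs
        · nlinarith [sq_nonneg (x + y), mul_nonneg hk.le hxy]
        · nlinarith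
        · nlinarith
        · simp
      · refine ⟨0, le_rfl, by nlinarith, fun w hw => ?_⟩
        rw [hfw w hw, hfu, hfv]
        simp only [hα, hβ]
        split_ifs
        · nlinarith [sq_nonneg (x + y), mul_nonneg hk.le (sq_nonneg (x + y))]
        · nlinarith [mul_nonneg hk.le (sq_nonneg x)]
        · nlinarith [mul_nonneg hk.le (sq_nonneg y)]
        · simp
    have hsum := Finset.sum_le_sum hmw
    rw [Finset.sum_add_distrib, Finset.sum_add_distrib, ← Finset.mul_sum, ← Finset.mul_sum,
      ← Finset.mul_sum] at hsum
    rw [hfu, hfv] at hsum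
    rw [if_pos hadj, hff, hfu, hfv, ← hS]
    have hA : k * ((k ^ 2 + m) * x ^ 2) ≤ (k ^ 2 + m) * x ^ 2 * ∑ w ∈ S, α w := by
      rw [mul_comm]
      exact mul_le_mul_of_nonneg_left (by linarith) (by positivity)
    have hB : k * ((k ^ 2 + m) * y ^ 2) ≤ (k ^ 2 + m) * y ^ 2 * ∑ w ∈ S, β w := by
      rw [mul_comm]
      exact mul_le_mul_of_nonneg_left (by linarith) (by positivity)
    have hm' := mul_le_mul_of_nonneg_left hm hk.le
    have hu' : k * ((k ^ 2 + m) * x ^ 2) + k * ((k ^ 2 + m) * y ^ 2) =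
        k ^ 3 * (x ^ 2 + y ^ 2) + k * (m * (x ^ 2 + y ^ 2)) := by ring
    linarith

/-- In a graph with at least two edges, if two distinct vertices have degree at least `b`, then
at least two Laplacian eigenvalues are at least `b`. -/
theorem exists_ne_le_eigenvalues (hL : (G.lapMatrix ℝ).IsHermitian) {u v : V} {b : ℕ}
    (hcard : 1 < G.edgeSet.ncard) (huv : u ≠ v) (hu : b ≤ G.degree u) (hv : b ≤ G.degree v)
    (i₀ : V) : ∃ i, i ≠ i₀ ∧ (b : ℝ) ≤ hL.eigenvalues i := by
  have large : ∀ {b : ℕ} {u v : V}, 2 ≤ b → G.Adj u v → b ≤ G.degree u → b ≤ G.degree v →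
      ∃ i, i ≠ i₀ ∧ (b : ℝ) ≤ hL.eigenvalues i := by
    intro b u v hb hadj hu hv
    have hb' : (2 : ℝ) ≤ b := by exact_mod_cast hb
    have := G.exists_ne_le_eigenvalues_of_adj hL (k := (b : ℝ) - 1) (by linarith) hadj
      (by simpa using hu) (by simpa using hv) i₀
    simpa using this
  by_cases hadj : G.Adj u v
  swap
  · exact G.exists_ne_le_eigenvalues_of_not_adj hL huv hadj (by exact_mod_cast hu)
      (by exact_mod_cast hv) i₀
  rcases le_or_gt 2 b with hb | hb
  · exact large hb hadj hu hv
  have hb1 : (b : ℝ) ≤ 1 := by exact_mod_cast Nat.lt_succ_iff.1 hb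
  obtain ⟨w, hwu, hwv, z, hwz⟩ : ∃ w, w ≠ u ∧ w ≠ v ∧ ∃ z, G.Adj w z := by
    obtain ⟨e, he, hne⟩ := Set.exists_ne_of_one_lt_ncard hcard s(u, v)
    induction e with | _ x y
    rw [mem_edgeSet] at he
    by_contra! hcon
    have hx : x = u ∨ x = v := by
      by_contra! h
      exact hcon x h.1 h.2 y he
    have hy : y = u ∨ y = v := by
      by_contra! h
      exact hcon y h.1 h.2 x he.symm
    rcases hx with rfl | rfl <;> rcases hy with rfl | rfl
    · exact he.ne rfl
    · exact hne rfl
    · exact hne Sym2.eq_swap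
    · exact he.ne rfl
  have pos : ∀ {x y : V}, G.Adj x y → b ≤ G.degree x := fun h =>
    (Nat.lt_succ_iff.1 hb).trans ((G.degree_pos_iff_exists_adj _).2 ⟨_, h⟩)
  by_cases h1 : G.Adj u w
  swap
  · exact G.exists_ne_le_eigenvalues_of_not_adj hL hwu.symm h1 (by exact_mod_cast pos hadj)
      (by exact_mod_cast pos hwz) i₀
  by_cases h2 : G.Adj v w
  swap
  · exact G.exists_ne_le_eigenvalues_of_not_adj hL hwv.symm h2 (by exact_mod_cast pos hadj.symm)
      (by exact_mod_cast pos hwz) i₀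
  have two : ∀ {x y z : V}, y ≠ z → G.Adj x y → G.Adj x z → 2 ≤ G.degree x := by
    intro x y z hyz hy hz
    rw [← card_neighborFinset_eq_degree, ← Finset.card_pair hyz]
    refine Finset.card_le_card fun t ht => ?_
    rw [Finset.mem_insert, Finset.mem_singleton] at ht
    rcases ht with rfl | rfl <;> simpa
  obtain ⟨i, hi, h⟩ := large le_rfl hadj (two hwv.symm hadj h1) (two hwu.symm hadj.symm h2)
  exact ⟨i, hi, by push_cast at h; linarith⟩

end SimpleGraph

theorem le_degSeq_zero {n : ℕ} (hn : 0 < n) (G : SimpleGraph (Fin n)) [inst : DecidableRel G.Adj]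
    (v : Fin n) : G.degree v ≤ degSeq G ⟨0, hn⟩ := by
  obtain rfl : inst = Classical.decRel G.Adj := Subsingleton.elim _ _
  let := Classical.decRel G.Adj
  exact Tuple.le_sort_rev_zero (fun v => G.degree v) hn v

theorem exists_degree_eq_degSeq {n : ℕ} (h0 : 0 < n) (h1 : 1 < n) (G : SimpleGraph (Fin n))
    [inst : DecidableRel G.Adj] : ∃ u v, u ≠ v ∧ G.degree u = degSeq G ⟨0, h0⟩ ∧
      G.degree v = degSeq G ⟨1, h1⟩ ∧ G.degree v ≤ G.degree u := by
  obtain rfl : inst = Classical.decRel G.Adj := Subsingleton.elim _ _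
  let := Classical.decRel G.Adj
  exact ⟨Tuple.sort (fun v => G.degree v) (Fin.rev ⟨0, h0⟩),
    Tuple.sort (fun v => G.degree v) (Fin.rev ⟨1, h1⟩),
    (Tuple.sort _).injective.ne (Fin.rev_injective.ne (by simp)), rfl, rfl,
    Tuple.monotone_sort (fun v => G.degree v) (Fin.rev_le_rev.2 (Fin.mk_le_mk.2 zero_le_one))⟩

/-- If `G` has at least one edge, largest degree `d₁` and second largest
degree `d₂`, and `G'` is obtained from `G` by adding `h ≥ 1` new edges, then
`μ₁(G') ≥ 1 + d₁` and `μ₂(G') ≥ d₂`. -/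
theorem laplacian_top_eigenvalues_add_links {n h d₁ d₂ : ℕ}
    (hn : 2 ≤ n)
    (G G' : SimpleGraph (Fin n))
    (hne : G.edgeSet.Nonempty)
    (hd₁ : d₁ = degSeq G ⟨0, by omega⟩)
    (hd₂ : d₂ = degSeq G ⟨1, by omega⟩)
    (hsub : G ≤ G')
    (hm' : G'.edgeSet.ncard = G.edgeSet.ncard + h)
    (hh : 1 ≤ h) :
    1 + (d₁ : ℝ) ≤ lapEigs G' ⟨0, by omega⟩ ∧ (d₂ : ℝ) ≤ lapEigs G' ⟨1, by omega⟩ := by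
  let := Classical.decRel G.Adj
  let := Classical.decRel G'.Adj
  let := fun (a b : Fin n) => Classical.dec (a = b)
  obtain ⟨u, v, huv, hu, hv, hle⟩ := exists_degree_eq_degSeq (by omega) (by omega) G
  rw [← hu] at hd₁
  rw [← hv] at hd₂
  have hu' : G.degree u ≤ G'.degree u := SimpleGraph.degree_le_of_le hsub
  have hv' : G.degree v ≤ G'.degree v := SimpleGraph.degree_le_of_le hsub
  have hpos : 0 < G.edgeSet.ncard := (Set.ncard_pos (Set.toFinite _)).2 hne
  constructor
  · have hupos : 0 < G.degree u := by
      obtain ⟨e, he⟩ := hne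
      induction e with | _ x y
      exact ((G.degree_pos_iff_exists_adj x).2 ⟨y, he⟩).trans_le
        ((le_degSeq_zero (by omega) G x).trans hu.ge)
    obtain ⟨i, hi⟩ := G'.exists_degree_add_one_le_eigenvalues
      (G'.posSemidef_lapMatrix ℝ).isHermitian (hupos.trans_le hu')
    refine le_trans ?_ (hi.trans (Tuple.le_sort_rev_zero _ (by omega) i))
    rw [hd₁]
    gcongr
  · refine Tuple.le_sort_rev_one _ (by omega) fun i₀ => ?_
    exact G'.exists_ne_le_eigenvalues (G'.posSemidef_lapMatrix ℝ).isHermitian (by omega) huv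
      (by omega) (by omega) i₀
end

section
/- Let G be a simple graph on n vertices with largest degree d₁ and second largest degree d₂, and let G″ be a simple graph on the same vertex set obtained from G by removing h ≥ 1 of its edges, where h < d₂/2. Then the two largest Laplacian eigenvalues of G″ satisfy μ₁(G″) ≥ 1 + d₁ − 2h and μ₂(G″) ≥ d₂ − 2h. -/
open Finset

open Matrix in
/-- If `x` is orthogonal to every eigenvector with eigenvalue exceeding `c`, then the quadratic
form of `A` at `x` is at most `c` times the squared length of `x`. -/
theorem dotProduct_mulVec_le_of_orthogonal {V : Type*} [Fintype V] [DecidableEq V]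
    {A : Matrix V V ℝ} (hA : A.IsHermitian) (c : ℝ) (x : V → ℝ)
    (hx : ∀ i, c < hA.eigenvalues i → (hA.eigenvectorBasis i).ofLp ⬝ᵥ x = 0) :
    x ⬝ᵥ A *ᵥ x ≤ c * (x ⬝ᵥ x) := by
  have parseval (y : V → ℝ) : x ⬝ᵥ y =
      ∑ i, ((hA.eigenvectorBasis i).ofLp ⬝ᵥ x) * ((hA.eigenvectorBasis i).ofLp ⬝ᵥ y) := by
    have h := hA.eigenvectorBasis.sum_inner_mul_inner (WithLp.toLp 2 x) (WithLp.toLp 2 y)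
    simp only [EuclideanSpace.inner_eq_star_dotProduct, star_trivial] at h
    rw [dotProduct_comm x y, ← h]
    refine Finset.sum_congr rfl fun i _ => ?_
    rw [dotProduct_comm y]
  have eig (i : V) : (hA.eigenvectorBasis i).ofLp ⬝ᵥ A *ᵥ x =
      hA.eigenvalues i * ((hA.eigenvectorBasis i).ofLp ⬝ᵥ x) := by
    have hT : Aᵀ = A := by simpa using hA.eq
    rw [dotProduct_mulVec, ← mulVec_transpose, hT, hA.mulVec_eigenvectorBasis, smul_dotProduct,
      smul_eq_mul]
  rw [parseval (A *ᵥ x), parseval x, Finset.mul_sum]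
  refine Finset.sum_le_sum fun i _ => ?_
  rw [eig]
  rcases le_or_gt (hA.eigenvalues i) c with h | h
  · nlinarith [mul_le_mul_of_nonneg_right h
      (mul_self_nonneg ((hA.eigenvectorBasis i).ofLp ⬝ᵥ x))]
  · simp [hx i h]

open Matrix in
/-- Diagonal entries of a Hermitian matrix are bounded by any upper bound of its eigenvalues. -/
theorem diag_le_of_eigenvalues_le {V : Type*} [Fintype V] [DecidableEq V]
    {A : Matrix V V ℝ} (hA : A.IsHermitian) {c : ℝ} (hc : ∀ i, hA.eigenvalues i ≤ c) (v : V) :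
    A v v ≤ c := by
  have h := dotProduct_mulVec_le_of_orthogonal hA c (Pi.single v 1)
    fun i hi => absurd (hc i) (not_le.mpr hi)
  simpa using h

open Matrix in
/-- Suppose all eigenvalues of a Hermitian matrix but one are at most `c`. If it has a `2 × 2`
principal submatrix with diagonal entries at least `m` and off-diagonal entries in `[-1, 1]`,
then `m - 1 ≤ c`. -/
theorem sub_one_le_of_eigenvalues_le {V : Type*} [Fintype V] [DecidableEq V]
    {A : Matrix V V ℝ} (hA : A.IsHermitian) {c m : ℝ} (k : V)
    (hc : ∀ i, i ≠ k → hA.eigenvalues i ≤ c) {u v : V} (huv : u ≠ v)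
    (hu : m ≤ A u u) (hv : m ≤ A v v) (hoff : |A u v| ≤ 1) : m - 1 ≤ c := by
  obtain ⟨a, b, hab, horth⟩ : ∃ a b : ℝ, 0 < a ^ 2 + b ^ 2 ∧
      (hA.eigenvectorBasis k).ofLp u * a + (hA.eigenvectorBasis k).ofLp v * b = 0 := by
    by_cases h : (hA.eigenvectorBasis k).ofLp u = 0
    · exact ⟨1, 0, by norm_num, by simp [h]⟩
    · exact ⟨-(hA.eigenvectorBasis k).ofLp v, (hA.eigenvectorBasis k).ofLp u, by positivity,
        by ring⟩
  have h := dotProduct_mulVec_le_of_orthogonal hA c (Pi.single u a + Pi.single v b) (by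
    intro i hi
    obtain rfl : i = k := by
      by_contra hik
      exact absurd (hc i hik) (not_le.mpr hi)
    simpa [dotProduct_add] using horth)
  have hsymm : A v u = A u v := by simpa using hA.apply u v
  have hform : (Pi.single u a + Pi.single v b) ⬝ᵥ A *ᵥ (Pi.single u a + Pi.single v b) =
      A u u * a ^ 2 + 2 * A u v * (a * b) + A v v * b ^ 2 := by
    simp [mulVec_add, add_dotProduct, dotProduct_add, hsymm]
    ring
  have hnorm : (Pi.single u a + Pi.single v b) ⬝ᵥ (Pi.single u a + Pi.single v b) =
      a ^ 2 + b ^ 2 := by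
    simp [dotProduct_add, huv, huv.symm]
    ring
  rw [hform, hnorm] at h
  obtain ⟨h₁, h₂⟩ := abs_le.mp hoff
  refine le_of_mul_le_mul_right ?_ hab
  nlinarith [mul_le_mul_of_nonneg_right hu (sq_nonneg a),
    mul_le_mul_of_nonneg_right hv (sq_nonneg b),
    mul_nonneg (by linarith : 0 ≤ 1 + A u v) (sq_nonneg (a + b)),
    mul_nonneg (by linarith : 0 ≤ 1 - A u v) (sq_nonneg (a - b))]

/-- Passing to a spanning subgraph lowers a degree by at most the number of removed edges. -/
theorem degree_add_ncard_edgeSet_le {V : Type*} [Fintype V] {G H : SimpleGraph V}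
    [DecidableRel G.Adj] [DecidableRel H.Adj] (hle : H ≤ G) (v : V) :
    G.degree v + H.edgeSet.ncard ≤ H.degree v + G.edgeSet.ncard := by
  classical
  have hdeg (K : SimpleGraph V) [DecidableRel K.Adj] :
      (K.incidenceSet v).ncard = K.degree v := by
    rw [← K.card_incidenceSet_eq_degree v, Set.ncard_eq_toFinset_card', Set.toFinset_card]
  have hinc : H.incidenceSet v ⊆ G.incidenceSet v := fun e he =>
    ⟨SimpleGraph.edgeSet_mono hle he.1, he.2⟩
  have h₁ := Set.ncard_sdiff_add_ncard_of_subset hinc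
  have h₂ := Set.ncard_sdiff_add_ncard_of_subset (SimpleGraph.edgeSet_mono hle)
  have h₃ : (G.incidenceSet v \ H.incidenceSet v).ncard ≤ (G.edgeSet \ H.edgeSet).ncard :=
    Set.ncard_le_ncard fun e he => ⟨he.1.1, fun h => he.2 ⟨h, he.1.2⟩⟩
  rw [hdeg, hdeg] at h₁
  omega

/-- The value of a sequence sorted in non-increasing order at `j` bounds all values of the
sequence except those placed before `j`. -/
theorem le_sort_rev {n : ℕ} (f : Fin n → ℝ) (j i : Fin n)
    (h : j ≤ ((Tuple.sort f).symm i).rev) : f i ≤ (f ∘ Tuple.sort f) j.rev := by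
  have := Tuple.monotone_sort f (Fin.le_rev_iff.mp h)
  simpa using this

/-- If `G` has largest degree `d₁` and second largest degree `d₂`, and
`G''` is obtained from `G` by removing `h ≥ 1` of its edges with `h < d₂/2`, then
`μ₁(G'') ≥ 1 + d₁ − 2h` and `μ₂(G'') ≥ d₂ − 2h`. -/
theorem laplacian_top_eigenvalues_remove_links {n h d₁ d₂ : ℕ}
    (hn : 2 ≤ n)
    (G G'' : SimpleGraph (Fin n))
    (hd₁ : d₁ = degSeq G ⟨0, by omega⟩)
    (hd₂ : d₂ = degSeq G ⟨1, by omega⟩)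
    (hsub : G'' ≤ G)
    (hm'' : G''.edgeSet.ncard = G.edgeSet.ncard - h)
    (hh : 1 ≤ h)
    (hh₂ : (h : ℝ) < (d₂ : ℝ) / 2) :
    1 + (d₁ : ℝ) - 2 * (h : ℝ) ≤ lapEigs G'' ⟨0, by omega⟩ ∧
      (d₂ : ℝ) - 2 * (h : ℝ) ≤ lapEigs G'' ⟨1, by omega⟩ := by
  classical
  set σ := Tuple.sort fun v => G.degree v with hσ
  have hu : d₁ = G.degree (σ (Fin.rev ⟨0, by omega⟩)) := by
    rw [hd₁, hσ]; unfold degSeq; simp only [Function.comp]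
  have hv : d₂ = G.degree (σ (Fin.rev ⟨1, by omega⟩)) := by
    rw [hd₂, hσ]; unfold degSeq; simp only [Function.comp]
  have hd : d₂ ≤ d₁ := by
    rw [hu, hv]
    exact Tuple.monotone_sort (fun v => G.degree v) (Fin.rev_le_rev.mpr (by simp [Fin.le_def]))
  have huv : σ (Fin.rev ⟨0, by omega⟩) ≠ σ (Fin.rev ⟨1, by omega⟩) := by
    simp [Fin.ext_iff]
    omega
  generalize σ (Fin.rev ⟨0, by omega⟩) = u at *
  generalize σ (Fin.rev ⟨1, by omega⟩) = v at *
  have hdeg (w : Fin n) : (G.degree w : ℝ) ≤ G''.degree w + h := by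
    have := degree_add_ncard_edgeSet_le hsub w
    exact_mod_cast (by omega : G.degree w ≤ G''.degree w + h)
  have hh' : (1 : ℝ) ≤ h := by exact_mod_cast hh
  have hd' : (d₂ : ℝ) ≤ d₁ := by exact_mod_cast hd
  have hdu := hdeg u
  have hdv := hdeg v
  rw [← hu] at hdu
  rw [← hv] at hdv
  have hA := (G''.posSemidef_lapMatrix ℝ).isHermitian
  have hlap : lapEigs G'' = fun i => (hA.eigenvalues ∘ Tuple.sort hA.eigenvalues) i.rev := by
    unfold lapEigs
    congr!
  have hdiag (w : Fin n) : G''.lapMatrix ℝ w w = G''.degree w := by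
    simp [SimpleGraph.lapMatrix, SimpleGraph.degMatrix]
  rw [hlap]
  constructor
  · have := diag_le_of_eigenvalues_le hA
      (fun i => le_sort_rev hA.eigenvalues ⟨0, by omega⟩ i (by simp [Fin.le_def])) u
    rw [hdiag] at this
    linarith
  · have := sub_one_le_of_eigenvalues_le (m := d₂ - h) hA
      (Tuple.sort hA.eigenvalues (Fin.rev ⟨0, by omega⟩))
      (fun i hi => le_sort_rev hA.eigenvalues ⟨1, by omega⟩ i ?_) huv
      (by rw [hdiag]; linarith) (by rw [hdiag]; linarith) ?_
    · linarith
    · rw [Fin.le_def]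
      by_contra hlt
      refine hi ?_
      rw [← Equiv.symm_apply_eq, ← Fin.rev_inj, Fin.rev_rev, Fin.ext_iff]
      exact Nat.lt_one_iff.mp (not_le.mp hlt)
    · simp only [SimpleGraph.lapMatrix, SimpleGraph.degMatrix, Matrix.sub_apply,
        Matrix.diagonal_apply_ne _ huv, SimpleGraph.adjMatrix_apply]
      split_ifs <;> simp
end
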